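/- arXiv:2210.11530 — 2 statements merged into one kernel-verified Lean document; each statement's English description precedes it below -/
import Mathlib

section
/- Let {X_t}_{t∈ℤ} be a strictly stationary process such that there is a constant c > 0 with the property that for all integers i, j and all events A in the σ-algebra generated by X_i and B in the σ-algebra generated by X_j, |P(A∩B) − P(A)P(B)| ≤ exp(−c·|i−j|). Let f be a measurable function with sup_x |f(x)| < M, let α > 0, let (a_n)_{n≥1} be real numbers with |a_n| ≤ n^α, and set Y_{ni} := a_n·f(X_i). Then for every n ≥ 1: Var(Y_{n0}) + 2·∑_{i>0} |Cov(Y_{n0}, Y_{ni})| ≤ (⌊24·α·log(n)/c⌋ + 3)·Var(Y_{n0}) + 22·M²/(n^{2α}·(e^{c/3} − 1)), where ⌊x⌋ denotes the greatest integer ≤ x. -/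
open MeasureTheory ProbabilityTheory

/-- If the integrals of `h` over all events of a sub-σ-algebra `m` are at most `ε` in absolute value,
then its integral against an `m`-measurable function bounded by `K` is at most `2 * K * ε`. -/
lemma abs_integral_mul_le_of_forall_abs_setIntegral_le {Ω : Type*} [Nonempty Ω]
    {m m₀ : MeasurableSpace Ω} {μ : Measure Ω} [IsFiniteMeasure μ] (hm : m ≤ m₀)
    {U h : Ω → ℝ} {K ε : ℝ}
    (hU : StronglyMeasurable[m] U) (hUK : ∀ ω, |U ω| ≤ K) (hh : Integrable h μ)
    (hε : ∀ A, MeasurableSet[m] A → |∫ ω in A, h ω ∂μ| ≤ ε) :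
    |∫ ω, U ω * h ω ∂μ| ≤ 2 * K * ε := by
  obtain ⟨ω₀⟩ := ‹Nonempty Ω›
  have hK : 0 ≤ K := (abs_nonneg _).trans (hUK ω₀)
  set g : Ω → ℝ := μ[h | m]
  have hgint : Integrable g μ := integrable_condExp
  have hgm : StronglyMeasurable[m] g := stronglyMeasurable_condExp
  have hpull : μ[U * h | m] =ᵐ[μ] U * g :=
    condExp_stronglyMeasurable_mul_of_bound hm hU hh K (.of_forall hUK)
  have hUg : ∫ ω, U ω * h ω ∂μ = ∫ ω, U ω * g ω ∂μ :=
    (integral_condExp (f := U * h) hm).symm.trans (integral_congr_ae hpull)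
  set A : Set Ω := {ω | 0 ≤ g ω}
  have hAm : MeasurableSet[m] A := measurableSet_le measurable_const hgm.measurable
  have hgA : ∫ ω in A, |g ω| ∂μ = ∫ ω in A, h ω ∂μ := by
    rw [← setIntegral_condExp hm hh hAm]
    exact setIntegral_congr_fun (hm _ hAm) fun ω hω => abs_of_nonneg hω
  have hgAc : ∫ ω in Aᶜ, |g ω| ∂μ = -∫ ω in Aᶜ, h ω ∂μ := by
    rw [← setIntegral_condExp hm hh hAm.compl, ← integral_neg]
    exact setIntegral_congr_fun (hm _ hAm.compl) fun ω hω => abs_of_neg (not_le.mp hω)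
  have hgabs : ∫ ω, |g ω| ∂μ ≤ 2 * ε := by
    rw [← integral_add_compl (hm _ hAm) hgint.abs, hgA, hgAc]
    linarith [(abs_le.mp (hε A hAm)).2, (abs_le.mp (hε Aᶜ hAm.compl)).1]
  calc |∫ ω, U ω * h ω ∂μ| = |∫ ω, U ω * g ω ∂μ| := by rw [hUg]
    _ ≤ ∫ ω, |U ω * g ω| ∂μ := abs_integral_le_integral_abs
    _ ≤ ∫ ω, K * |g ω| ∂μ := by
        refine integral_mono_of_nonneg (.of_forall fun ω => abs_nonneg _) (hgint.abs.const_mul K)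
          (.of_forall fun ω => ?_)
        simp only [abs_mul]
        exact mul_le_mul_of_nonneg_right (hUK ω) (abs_nonneg _)
    _ = K * ∫ ω, |g ω| ∂μ := integral_const_mul _ _
    _ ≤ 2 * K * ε := by nlinarith

/-- **Ibragimov's covariance inequality** for bounded functions: the covariance is at most four
times the product of the bounds and the strong mixing coefficient. -/
lemma abs_covariance_le_of_forall_abs_measureReal_inter_sub_le {Ω : Type*}
    {m₁ m₂ m₀ : MeasurableSpace Ω} {μ : Measure Ω} [IsProbabilityMeasure μ]
    (hm₁ : m₁ ≤ m₀) (hm₂ : m₂ ≤ m₀) {U V : Ω → ℝ} {K L ε : ℝ}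
    (hU : StronglyMeasurable[m₁] U) (hV : StronglyMeasurable[m₂] V)
    (hUK : ∀ ω, |U ω| ≤ K) (hVL : ∀ ω, |V ω| ≤ L)
    (hε : ∀ A B, MeasurableSet[m₁] A → MeasurableSet[m₂] B →
      |μ.real (A ∩ B) - μ.real A * μ.real B| ≤ ε) :
    |cov[U, V; μ]| ≤ 4 * K * L * ε := by
  have : Nonempty Ω := nonempty_of_isProbabilityMeasure μ
  have hVint : Integrable V μ := .of_bound (hV.mono hm₂).aestronglyMeasurable L (.of_forall hVL)
  have hVA (A : Set Ω) (hA : MeasurableSet[m₁] A) :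
      |∫ ω in A, (V ω - ∫ x, V x ∂μ) ∂μ| ≤ 2 * L * ε := by
    have hind : Integrable (A.indicator (1 : Ω → ℝ)) μ :=
      (integrable_const (1 : ℝ)).indicator (hm₁ _ hA)
    have key := abs_integral_mul_le_of_forall_abs_setIntegral_le (μ := μ) (ε := ε) hm₂ hV hVL
      (h := fun ω => A.indicator 1 ω - μ.real A) (hind.sub (integrable_const _)) fun B hB => by
        rw [integral_sub hind.integrableOn (integrable_const _), integral_indicator_one (hm₁ _ hA),
          measureReal_restrict_apply (hm₁ _ hA), setIntegral_const, smul_eq_mul, mul_comm]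
        exact hε A B hA hB
    convert key using 2
    have hVind (ω : Ω) : V ω * A.indicator 1 ω = A.indicator V ω := by
      by_cases hω : ω ∈ A <;> simp [hω]
    simp only [mul_sub, hVind]
    rw [integral_sub hVint.integrableOn (integrable_const _), integral_sub
      (hVint.indicator (hm₁ _ hA)) (hVint.mul_const _), integral_indicator (hm₁ _ hA),
      setIntegral_const, integral_mul_const, smul_eq_mul, mul_comm]
  have hcov : cov[U, V; μ] = ∫ ω, U ω * (V ω - ∫ x, V x ∂μ) ∂μ := by
    have hU2 : MemLp U 2 μ := .of_bound (hU.mono hm₁).aestronglyMeasurable K (.of_forall hUK)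
    have hV2 : MemLp V 2 μ := .of_bound hVint.1 L (.of_forall hVL)
    have hmean : ∫ ω, (V ω - ∫ x, V x ∂μ) ∂μ = 0 := by
      rw [integral_sub hVint (integrable_const _)]; simp
    have hsub : cov[U, fun ω => V ω - ∫ x, V x ∂μ; μ] = ∫ ω, U ω * (V ω - ∫ x, V x ∂μ) ∂μ
        - (∫ ω, U ω ∂μ) * ∫ ω, (V ω - ∫ x, V x ∂μ) ∂μ :=
      covariance_eq_sub hU2 (hV2.sub (memLp_const _))
    rwa [covariance_sub_const_right hVint, hmean, mul_zero, sub_zero] at hsub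
  rw [hcov]
  refine (abs_integral_mul_le_of_forall_abs_setIntegral_le hm₁ hU hUK
    (hVint.sub (integrable_const _)) hVA).trans_eq (by ring)

/-- A covariance is at most the average of the two variances in absolute value. -/
lemma abs_covariance_le_half_add_variance {Ω : Type*} {m₀ : MeasurableSpace Ω} {μ : Measure Ω}
    [IsProbabilityMeasure μ] {U V : Ω → ℝ} (hU : MemLp U 2 μ) (hV : MemLp V 2 μ) :
    |cov[U, V; μ]| ≤ (Var[U; μ] + Var[V; μ]) / 2 := by
  have hadd := variance_add hU hV
  have hsub := variance_sub hU hV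
  have := variance_nonneg (U + V) μ
  have := variance_nonneg (U - V) μ
  exact abs_le.mpr ⟨by linarith, by linarith⟩

/-- A series bounded termwise both by `v` and by a geometric sequence: use the first bound for `N`
terms and the second one for the remainder. -/
lemma tsum_le_of_le_of_le_exp {s : ℕ → ℝ} {v K c : ℝ} (hc : 0 < c) (h0 : ∀ i, 0 ≤ s i)
    (hv : ∀ i, s i ≤ v) (hK : ∀ i, s i ≤ K * Real.exp (-c * (i + 1))) (N : ℕ) :
    ∑' i, s i ≤ N * v + K * Real.exp (-c * N) / (Real.exp c - 1) := by
  have hr : Real.exp (-c) < 1 := by simpa using hc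
  have hgeom := hasSum_geometric_of_lt_one (Real.exp_pos (-c)).le hr
  have hexp (i : ℕ) : Real.exp (-c * (i + 1)) = Real.exp (-c) * Real.exp (-c) ^ i := by
    rw [← Real.exp_nat_mul, ← Real.exp_add]; ring_nf
  have hsum : Summable s := .of_nonneg_of_le h0 (fun i => (hK i).trans_eq
    (by rw [hexp, ← mul_assoc])) (hgeom.summable.mul_left (K * Real.exp (-c)))
  rw [← hsum.sum_add_tsum_nat_add N]
  gcongr
  · simpa using Finset.sum_le_card_nsmul (Finset.range N) s v fun i _ => hv i
  · have htail : HasSum (fun i : ℕ => K * Real.exp (-c * N) * Real.exp (-c) * Real.exp (-c) ^ i)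
        (K * Real.exp (-c * N) * Real.exp (-c) * (1 - Real.exp (-c))⁻¹) := hgeom.mul_left _
    calc ∑' i, s (i + N)
        ≤ K * Real.exp (-c * N) * Real.exp (-c) * (1 - Real.exp (-c))⁻¹ := by
          refine hasSum_le (fun i => (hK (i + N)).trans_eq ?_)
            ((summable_nat_add_iff N).mpr hsum).hasSum htail
          rw [hexp, pow_add, ← Real.exp_nat_mul (-c) N, mul_comm (N : ℝ) (-c)]
          ring
      _ = K * Real.exp (-c * N) / (Real.exp c - 1) := by
          have h1 : Real.exp c - 1 ≠ 0 := by
            have := Real.add_one_lt_exp hc.ne'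
            linarith
          have h2 : 1 - Real.exp (-c) = Real.exp (-c) * (Real.exp c - 1) := by
            rw [mul_sub, ← Real.exp_add]; simp
          rw [h2]
          field_simp

/-- Lemma 2 of the paper: with `Y_{ni} := a_n·f(X_i)`, under the event-level
mixing bound, `Var(Y_{n0}) + 2∑_{i>0}|Cov(Y_{n0},Y_{ni})| ≤ (⌊24α·log n/c⌋ + 3)·Var(Y_{n0})
+ 22M²/(n^{2α}(e^{c/3} − 1))`. -/
theorem statement3 {Ω E : Type*} [MeasureSpace Ω] [IsProbabilityMeasure (volume : Measure Ω)]
    [MeasurableSpace E]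
    (X : ℤ → Ω → E) (hXmeas : ∀ i, Measurable (X i))
    (hstat : ∀ (t : ℤ) (k : ℕ) (B : Set (Fin k → E)), MeasurableSet B →
      volume {ω | (fun i : Fin k => X (t + (i : ℤ)) ω) ∈ B}
        = volume {ω | (fun i : Fin k => X (i : ℤ) ω) ∈ B})
    (c : ℝ) (hc : 0 < c)
    (hmix : ∀ (i j : ℤ) (A B : Set Ω),
      MeasurableSet[MeasurableSpace.comap (X i) inferInstance] A →
      MeasurableSet[MeasurableSpace.comap (X j) inferInstance] B →
      |(volume (A ∩ B)).toReal - (volume A).toReal * (volume B).toReal|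
        ≤ Real.exp (-c * |(i : ℝ) - (j : ℝ)|))
    (f : E → ℝ) (hf : Measurable f) (M : ℝ) (hfM : ∀ x, |f x| < M)
    (α : ℝ) (hα : 0 < α)
    (a : ℕ → ℝ) (ha : ∀ n : ℕ, 1 ≤ n → |a n| ≤ (n : ℝ) ^ α) :
    ∀ n : ℕ, 1 ≤ n →
      -- `Var(Y_{n0}) + 2∑_{i>0} |Cov(Y_{n0}, Y_{ni})|`
      ((∫ ω, (a n * f (X 0 ω)) ^ 2) - (∫ ω, a n * f (X 0 ω)) ^ 2)
        + 2 * ∑' i : ℕ,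
            |(∫ ω, (a n * f (X 0 ω)) * (a n * f (X ((i : ℤ) + 1) ω)))
              - (∫ ω, a n * f (X 0 ω)) * (∫ ω, a n * f (X ((i : ℤ) + 1) ω))|
      ≤ ((⌊24 * α * Real.log n / c⌋ : ℝ) + 3)
          * ((∫ ω, (a n * f (X 0 ω)) ^ 2) - (∫ ω, a n * f (X 0 ω)) ^ 2)
        + 22 * M ^ 2 / ((n : ℝ) ^ (2 * α) * (Real.exp (c / 3) - 1)) := by
  intro n hn
  have hΩ : Nonempty Ω := nonempty_of_isProbabilityMeasure (volume : Measure Ω)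
  have hM : 0 < M := (abs_nonneg _).trans_lt (hfM (X 0 hΩ.some))
  have hn1 : (1 : ℝ) ≤ n := by exact_mod_cast hn
  have hn0 : (0 : ℝ) < n := by linarith
  set Y : ℤ → Ω → ℝ := fun i ω => a n * f (X i ω) with hY
  have hYm (i : ℤ) : Measurable (Y i) := (hf.comp (hXmeas i)).const_mul _
  have hYb (i : ℤ) (ω : Ω) : |Y i ω| ≤ (n : ℝ) ^ α * M := by
    rw [hY, abs_mul]
    exact mul_le_mul (ha n hn) (hfM _).le (abs_nonneg _) (by positivity)
  have hY2 (i : ℤ) : MemLp (Y i) 2 volume :=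
    .of_bound (hYm i).aestronglyMeasurable _ (.of_forall (hYb i))
  have hvar (i : ℤ) : Var[Y i; volume] = Var[Y 0; volume] := by
    have hident : IdentDistrib (X i) (X 0) volume volume := by
      refine ⟨(hXmeas i).aemeasurable, (hXmeas 0).aemeasurable, ?_⟩
      ext B hB
      rw [Measure.map_apply (hXmeas i) hB, Measure.map_apply (hXmeas 0) hB]
      simpa [Set.preimage] using hstat i 1 {x | x 0 ∈ B} (measurable_pi_apply 0 hB)
    exact (hident.comp (hf.const_mul (a n))).variance_eq
  have hvar0 : (∫ ω, (a n * f (X 0 ω)) ^ 2) - (∫ ω, a n * f (X 0 ω)) ^ 2 = Var[Y 0; volume] :=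
    (variance_eq_sub (hY2 0)).symm
  have hcov (i : ℕ) : (∫ ω, (a n * f (X 0 ω)) * (a n * f (X ((i : ℤ) + 1) ω)))
      - (∫ ω, a n * f (X 0 ω)) * (∫ ω, a n * f (X ((i : ℤ) + 1) ω))
      = cov[Y 0, Y ((i : ℤ) + 1); volume] :=
    (covariance_eq_sub (hY2 0) (hY2 _)).symm
  have hcomap (i : ℤ) : StronglyMeasurable[MeasurableSpace.comap (X i) inferInstance] (Y i) :=
    ((hf.const_mul (a n)).comp (comap_measurable (X i))).stronglyMeasurable
  have hcov_exp (i : ℕ) : |cov[Y 0, Y ((i : ℤ) + 1); volume]|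
      ≤ 4 * ((n : ℝ) ^ α * M) ^ 2 * Real.exp (-c * (i + 1)) := by
    refine (abs_covariance_le_of_forall_abs_measureReal_inter_sub_le (hXmeas _).comap_le
      (hXmeas _).comap_le (hcomap 0) (hcomap _) (hYb _) (hYb _) (hmix _ _)).trans_eq ?_
    have hlag : |((0 : ℤ) : ℝ) - (((i : ℤ) + 1 : ℤ) : ℝ)| = i + 1 := by
      push_cast
      rw [zero_sub, abs_neg, abs_of_nonneg (by positivity)]
    rw [hlag]
    ring
  have hcov_var (i : ℕ) : |cov[Y 0, Y ((i : ℤ) + 1); volume]| ≤ Var[Y 0; volume] := by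
    have := abs_covariance_le_half_add_variance (hY2 0) (hY2 ((i : ℤ) + 1))
    rw [hvar ((i : ℤ) + 1)] at this
    linarith
  simp only [hvar0, hcov]
  have hv := variance_nonneg (Y 0) volume
  set v := Var[Y 0; volume]
  set T := 24 * α * Real.log n / c with hT
  have hT0 : 0 ≤ T := by have := Real.log_nonneg hn1; positivity
  set N := ⌊T⌋₊ / 2 + 1
  have hfloor : ((⌊T⌋ : ℤ) : ℝ) = (⌊T⌋₊ : ℝ) := (natCast_floor_eq_intCast_floor hT0).symm
  have hN_le : 2 * (N : ℝ) ≤ ⌊T⌋₊ + 2 := by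
    have : 2 * N ≤ ⌊T⌋₊ + 2 := by omega
    exact_mod_cast this
  have hN_ge : T ≤ 2 * N := by
    have h1 : ⌊T⌋₊ + 1 ≤ 2 * N := by omega
    have h2 : (⌊T⌋₊ : ℝ) + 1 ≤ 2 * N := by exact_mod_cast h1
    linarith [Nat.lt_floor_add_one T]
  have hdecay : ((n : ℝ) ^ α) ^ 2 * Real.exp (-c * N) ≤ ((n : ℝ) ^ (2 * α))⁻¹ := by
    have hlog : 24 * α * Real.log n ≤ 2 * N * c := by rwa [hT, div_le_iff₀ hc] at hN_ge
    have := mul_nonneg hα.le (Real.log_nonneg hn1)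
    rw [Real.rpow_def_of_pos hn0, Real.rpow_def_of_pos hn0, ← Real.exp_nat_mul, ← Real.exp_add,
      ← Real.exp_neg, Real.exp_le_exp]
    push_cast
    nlinarith
  have hexp3 : 0 < Real.exp (c / 3) - 1 := by
    have := Real.add_one_le_exp (c / 3)
    linarith
  have hexp_le : Real.exp (c / 3) - 1 ≤ Real.exp c - 1 := by
    have : Real.exp (c / 3) ≤ Real.exp c := Real.exp_le_exp.mpr (by linarith)
    linarith
  have htail : 2 * (4 * ((n : ℝ) ^ α * M) ^ 2 * Real.exp (-c * N) / (Real.exp c - 1))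
      ≤ 22 * M ^ 2 / ((n : ℝ) ^ (2 * α) * (Real.exp (c / 3) - 1)) := by
    calc 2 * (4 * ((n : ℝ) ^ α * M) ^ 2 * Real.exp (-c * N) / (Real.exp c - 1))
        = 8 * M ^ 2 * (((n : ℝ) ^ α) ^ 2 * Real.exp (-c * N)) / (Real.exp c - 1) := by ring
      _ ≤ 22 * M ^ 2 * ((n : ℝ) ^ (2 * α))⁻¹ / (Real.exp (c / 3) - 1) := by
          gcongr
          norm_num
      _ = 22 * M ^ 2 / ((n : ℝ) ^ (2 * α) * (Real.exp (c / 3) - 1)) := by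
          rw [← div_eq_mul_inv, div_div]
  have hsum := tsum_le_of_le_of_le_exp hc (fun _ => abs_nonneg _) hcov_var hcov_exp N
  rw [hfloor]
  nlinarith [mul_le_mul_of_nonneg_right hN_le hv]
end

section
/- Let U and V be real-valued random variables on a common probability space with |U| < M and |V| < M almost surely, and suppose there is α ≥ 0 such that for all Borel sets A, B ⊂ ℝ: |P(U ∈ A, V ∈ B) − P(U ∈ A)·P(V ∈ B)| ≤ α. Then for every positive integer m: |Cov(U,V)| ≤ 2·M²/m + M²/(4·m²) + 4·m²·M²·α. -/
open MeasureTheory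

section CovarianceBounds

open Set

variable {Ω : Type*} [MeasurableSpace Ω] {P : Measure Ω} [IsProbabilityMeasure P]

/-- Layer-cake bound: if a centred integrable variable `Z` has integral at most `β` in absolute
value over every superlevel set of `V`, and `|V| < M` a.s., then `|E[Z V]| ≤ 2 M β`. -/
theorem abs_integral_mul_le_of_superlevel {Z V : Ω → ℝ} (hZ : Integrable Z P)
    (hZ0 : ∫ ω, Z ω ∂P = 0) (hV : Measurable V) {M β : ℝ} (hM : 0 ≤ M)
    (hVM : ∀ᵐ ω ∂P, |V ω| < M) (hβ : ∀ t : ℝ, |∫ ω in {ω | t < V ω}, Z ω ∂P| ≤ β) :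
    |∫ ω, Z ω * V ω ∂P| ≤ 2 * M * β := by
  have hS : MeasurableSet {p : Ω × ℝ | p.2 < V p.1} :=
    measurableSet_lt measurable_snd (hV.comp measurable_fst)
  let ν : Measure ℝ := volume.restrict (Ioc (-M) M)
  have hint : Integrable (fun p : Ω × ℝ ↦ {p : Ω × ℝ | p.2 < V p.1}.indicator
      (fun p ↦ Z p.1) p) (P.prod ν) := (hZ.comp_fst ν).indicator hS
  have hswap := integral_integral_swap
    (f := fun ω t ↦ {p : Ω × ℝ | p.2 < V p.1}.indicator (fun p ↦ Z p.1) (ω, t)) hint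
  have hleft : ∫ ω, ∫ t, {p : Ω × ℝ | p.2 < V p.1}.indicator (fun p ↦ Z p.1) (ω, t) ∂ν ∂P
      = ∫ ω, Z ω * V ω ∂P := by
    have hVint : Integrable (fun ω ↦ Z ω * V ω) P :=
      hZ.mul_bdd (c := M) hV.aestronglyMeasurable (hVM.mono fun ω h ↦ h.le)
    have hshift : ∫ ω, (Z ω * V ω + Z ω * M) ∂P = ∫ ω, Z ω * V ω ∂P := by
      rw [integral_add hVint (hZ.mul_const M), integral_mul_const, hZ0]
      ring
    rw [← hshift]
    refine integral_congr_ae (hVM.mono fun ω hω ↦ ?_)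
    obtain ⟨h₁, h₂⟩ := abs_lt.1 hω
    have heq : (fun t ↦ {p : Ω × ℝ | p.2 < V p.1}.indicator (fun p ↦ Z p.1) (ω, t))
        = (Iio (V ω)).indicator fun _ ↦ Z ω := by
      ext t
      simp [indicator]
    have hset : Iio (V ω) ∩ Ioc (-M) M = Ioo (-M) (V ω) := by
      ext t
      simp only [mem_inter_iff, mem_Iio, mem_Ioc, mem_Ioo]
      constructor
      · rintro ⟨h, h', -⟩
        exact ⟨h', h⟩
      · rintro ⟨h, h'⟩
        exact ⟨h', h, (h'.trans h₂).le⟩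
    simp only [heq, ν]
    rw [integral_indicator measurableSet_Iio, Measure.restrict_restrict measurableSet_Iio, hset,
      setIntegral_const, Real.volume_real_Ioo_of_le h₁.le, smul_eq_mul]
    ring
  rw [← hleft, hswap]
  have hbound := norm_integral_le_of_norm_le_const (μ := ν) (C := β)
    (f := fun t ↦ ∫ ω, {p : Ω × ℝ | p.2 < V p.1}.indicator (fun p ↦ Z p.1) (ω, t) ∂P)
    (Filter.Eventually.of_forall fun t ↦ by
      have heq : (fun ω ↦ {p : Ω × ℝ | p.2 < V p.1}.indicator (fun p ↦ Z p.1) (ω, t))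
          = {ω | t < V ω}.indicator Z := by
        ext ω
        simp [indicator]
      rw [heq, integral_indicator (measurableSet_lt measurable_const hV)]
      exact hβ t)
  have hν : ν.real univ = 2 * M := by
    simp only [ν, measureReal_restrict_apply_univ]
    rw [Real.volume_real_Ioc_of_le (by linarith)]
    ring
  rw [hν, mul_comm] at hbound
  exact hbound

/-- If the covariance of `W` with the indicator of every superlevel set of `V` is at most `β` in
absolute value, and `|V| < M` a.s., then `|Cov(W, V)| ≤ 2 M β`. -/
theorem abs_cov_le_of_superlevel {W V : Ω → ℝ} (hW : Integrable W P)
    (hV : Measurable V) {M β : ℝ} (hM : 0 ≤ M) (hVM : ∀ᵐ ω ∂P, |V ω| < M)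
    (hβ : ∀ t : ℝ, |∫ ω in {ω | t < V ω}, W ω ∂P
      - (∫ ω, W ω ∂P) * P.real {ω | t < V ω}| ≤ β) :
    |∫ ω, W ω * V ω ∂P - (∫ ω, W ω ∂P) * ∫ ω, V ω ∂P| ≤ 2 * M * β := by
  have hVint : Integrable V P :=
    Integrable.of_bound hV.aestronglyMeasurable M (hVM.mono fun ω h ↦ h.le)
  have hWV : Integrable (fun ω ↦ W ω * V ω) P :=
    hW.mul_bdd (c := M) hV.aestronglyMeasurable (hVM.mono fun ω h ↦ h.le)
  have h := abs_integral_mul_le_of_superlevel (Z := fun ω ↦ W ω - ∫ ω, W ω ∂P)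
    (hW.sub (integrable_const _))
    (by rw [integral_sub hW (integrable_const _)]; simp) hV hM hVM (β := β) fun t ↦ by
      rw [integral_sub hW.integrableOn (integrable_const _), setIntegral_const, smul_eq_mul,
        mul_comm (P.real _)]
      exact hβ t
  simp only [sub_mul] at h
  rwa [integral_sub hWV (hVint.const_mul _), integral_const_mul] at h

/-- Ibragimov's covariance inequality for bounded `α`-mixing variables. -/
theorem abs_cov_le_of_mixing {U V : Ω → ℝ} (hU : Measurable U) (hV : Measurable V) {M α : ℝ}
    (hM : 0 ≤ M) (hUM : ∀ᵐ ω ∂P, |U ω| < M) (hVM : ∀ᵐ ω ∂P, |V ω| < M)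
    (hmix : ∀ A B : Set ℝ, MeasurableSet A → MeasurableSet B →
      |P.real (U ⁻¹' A ∩ V ⁻¹' B) - P.real (U ⁻¹' A) * P.real (V ⁻¹' B)| ≤ α) :
    |∫ ω, U ω * V ω ∂P - (∫ ω, U ω ∂P) * ∫ ω, V ω ∂P| ≤ 4 * M ^ 2 * α := by
  have hUint : Integrable U P :=
    Integrable.of_bound hU.aestronglyMeasurable M (hUM.mono fun ω h ↦ h.le)
  have h := abs_cov_le_of_superlevel hUint hV hM hVM (β := 2 * M * α) fun t ↦ by
    have hB : MeasurableSet {ω | t < V ω} := measurableSet_lt measurable_const hV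
    have h := abs_cov_le_of_superlevel (W := {ω | t < V ω}.indicator fun _ ↦ (1 : ℝ))
      ((integrable_const (μ := P) (1 : ℝ)).indicator hB) hU hM hUM (β := α) fun s ↦ by
        have := hmix (Ioi s) (Ioi t) measurableSet_Ioi measurableSet_Ioi
        rw [setIntegral_indicator hB, integral_indicator hB, setIntegral_const,
          setIntegral_const, smul_eq_mul, smul_eq_mul, mul_one, mul_one, mul_comm (P.real _)]
        exact this
    have heq : (fun ω ↦ {ω | t < V ω}.indicator (fun _ ↦ (1 : ℝ)) ω * U ω)
        = {ω | t < V ω}.indicator U := by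
      ext ω
      simp [indicator]
    rw [heq, integral_indicator hB, integral_indicator hB, setIntegral_const, smul_eq_mul,
      mul_one, mul_comm (P.real _)] at h
    exact h
  linarith

end CovarianceBounds



/-- covariance discretization inequality. If `|U|, |V| < M` a.s. and the joint
distribution of `(U,V)` is `α`-close to the product of the marginals on all Borel rectangles,
then `|Cov(U,V)| ≤ 2M²/m + M²/(4m²) + 4m²M²α` for every positive integer `m`. -/
theorem statement6 {Ω : Type*} [MeasureSpace Ω] [IsProbabilityMeasure (volume : Measure Ω)]
    (U V : Ω → ℝ) (hU : Measurable U) (hV : Measurable V)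
    (M : ℝ) (hUM : ∀ᵐ ω, |U ω| < M) (hVM : ∀ᵐ ω, |V ω| < M)
    (α : ℝ) (hα : 0 ≤ α)
    (hmix : ∀ A B : Set ℝ, MeasurableSet A → MeasurableSet B →
      |(volume (U ⁻¹' A ∩ V ⁻¹' B)).toReal -
        (volume (U ⁻¹' A)).toReal * (volume (V ⁻¹' B)).toReal| ≤ α) :
    ∀ m : ℕ, 0 < m →
      |(∫ ω, U ω * V ω) - (∫ ω, U ω) * (∫ ω, V ω)|
        ≤ 2 * M ^ 2 / m + M ^ 2 / (4 * m ^ 2) + 4 * m ^ 2 * M ^ 2 * α := by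
  intro m hm
  have hM : 0 ≤ M := by
    obtain ⟨ω, hω⟩ := hUM.exists
    exact (abs_nonneg _).trans hω.le
  have hcov := abs_cov_le_of_mixing hU hV hM hUM hVM hmix
  have hm1 : (1 : ℝ) ≤ (m : ℝ) ^ 2 := one_le_pow₀ (by exact_mod_cast hm)
  have hmono : 4 * M ^ 2 * α ≤ 4 * (m : ℝ) ^ 2 * M ^ 2 * α := by
    nlinarith [mul_nonneg (sub_nonneg.2 hm1) (mul_nonneg (sq_nonneg M) hα)]
  have h₁ : 0 ≤ 2 * M ^ 2 / (m : ℝ) := by positivity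
  have h₂ : 0 ≤ M ^ 2 / (4 * (m : ℝ) ^ 2) := by positivity
  linarith
end
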